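/- arXiv:1803.10568 — 2 statements merged into one kernel-verified Lean document; each statement's English description precedes it below -/
import Mathlib

section
/- Let X_i ~ Mult(n_i, A_i p) independently for i = 1,…,L with A_i ∈ A(K_i, N), p a probability vector, n = Σ_i n_i, α_i = n_i/n, and let p̂ := (1/n)(A'A)^{-1} A' X̄ where A stacks the blocks α_i A_i and X̄ stacks the X_i, with A of rank N. Suppose α_i = n_i/n → α̃_i > 0 as n_i, n → ∞ with Σ_i α̃_i = 1, and let Ã stack the blocks α̃_i A_i. Then √n (p̂ − p) converges in distribution to a centered multivariate Gaussian vector G with covariance matrix Var[G] = (Ã'Ã)^{-1} ( Σ_{i=1}^{L} α̃_i^3 A_i' V(A_i p) A_i ) (Ã'Ã)^{-1}. -/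
open Matrix MeasureTheory ProbabilityTheory Filter Topology

/-- The probability mass function of the multinomial distribution `Mult(n, u)`:
the distribution of the vector of category counts of `n` i.i.d. categorical
random variables with probability vector `u`. -/
noncomputable def multinomialPMF {ι : Type*} [Fintype ι] (n : ℕ) (u : ι → ℝ)
    (x : ι → ℕ) : ℝ :=
  if (∑ i, x i) = n then
    (n.factorial : ℝ) / (∏ i, ((x i).factorial : ℝ)) * ∏ i, u i ^ x i
  else 0

/-- `V(u) = diag(u) − u u'`, the covariance matrix of one categorical draw with
probability vector `u` (so that `Mult(n,u)` has covariance `n V(u)`). -/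
noncomputable def Vmat {ι : Type*} [Fintype ι] [DecidableEq ι] (u : ι → ℝ) :
    Matrix ι ι ℝ :=
  Matrix.diagonal u - Matrix.vecMulVec u u

/-- A measure `μ` on `ℝ^N` is centered multivariate Gaussian with covariance matrix `Σ`
iff it is a probability measure and every linear functional `x ↦ ⟨t, x⟩` pushes it
forward to the one-dimensional Gaussian with mean `0` and variance `t' Σ t`. -/
def IsCenteredGaussianWithCov {N : ℕ} (μ : Measure (Fin N → ℝ))
    (Cov : Matrix (Fin N) (Fin N) ℝ) : Prop :=
  IsProbabilityMeasure μ ∧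
    ∀ t : Fin N → ℝ,
      μ.map (fun y => ∑ j, t j * y j) =
        gaussianReal 0 (Real.toNNReal (∑ j, ∑ k, t j * Cov j k * t k))

lemma tendsto_one_add_pow_exp_of_tendsto_mul {α : Type*} {l : Filter α} {k : α → ℕ} {g : α → ℂ}
    {t : ℂ} (hk : Tendsto k l atTop) (hg : Tendsto (fun a => (k a : ℂ) * g a) l (𝓝 t)) :
    Tendsto (fun a => (1 + g a) ^ k a) l (𝓝 (Complex.exp t)) := by
  have hk' : Tendsto (fun a => (k a : ℂ)⁻¹) l (𝓝 0) :=
    (tendsto_inv_atTop_nhds_zero_nat (𝕜 := ℂ)).comp hk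
  have hg0 : Tendsto g l (𝓝 0) := by
    have := hk'.mul hg
    rw [zero_mul] at this
    refine this.congr' ?_
    filter_upwards [hk.eventually_ne_atTop 0] with a ha
    field_simp
  have hd : HasDerivAt (fun z : ℂ => Complex.log (1 + z)) 1 0 := by
    have h : HasDerivAt (fun z : ℂ => 1 + z) 1 0 := (hasDerivAt_id 0).const_add 1
    simpa using h.clog (by simp)
  have hq : Tendsto (fun a => dslope (fun z : ℂ => Complex.log (1 + z)) 0 (g a)) l (𝓝 1) := by
    have hc := continuousAt_dslope_same.2 hd.differentiableAt
    have := hc.tendsto.comp hg0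
    rwa [dslope_same, hd.deriv] at this
  have hlim : Tendsto (fun a => (k a : ℂ) * Complex.log (1 + g a)) l (𝓝 t) := by
    have := hg.mul hq
    rw [mul_one] at this
    refine this.congr fun a => ?_
    have := sub_smul_dslope (fun z : ℂ => Complex.log (1 + z)) 0 (g a)
    simp only [sub_zero, smul_eq_mul, add_zero, Complex.log_one] at this
    rw [mul_assoc, this]
  refine ((Complex.continuous_exp.tendsto t).comp hlim).congr' ?_
  have hne : ∀ᶠ a in l, 1 + g a ≠ 0 := by
    have : Tendsto (fun a => 1 + g a) l (𝓝 (1 + 0)) := hg0.const_add 1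
    exact this.eventually_ne (by simp)
  filter_upwards [hne] with a ha
  simp [Complex.exp_nat_mul, Complex.exp_log ha]

lemma tendsto_mul_exp_sub_one_sub_self {α : Type*} {l : Filter α} {k : α → ℕ} {d : α → ℝ}
    {d₀ : ℝ} (hk : Tendsto k l atTop) (hd : Tendsto d l (𝓝 d₀)) :
    Tendsto (fun a => (k a : ℂ) * (Complex.exp ((d a / √(k a) : ℝ) * Complex.I) - 1
      - (d a / √(k a) : ℝ) * Complex.I)) l (𝓝 (-(d₀ ^ 2 / 2 : ℝ))) := by
  have hs : Tendsto (fun a => √(k a : ℝ)) l atTop :=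
    Real.tendsto_sqrt_atTop.comp (tendsto_natCast_atTop_atTop.comp hk)
  have hx : Tendsto (fun a => |d a / √(k a)|) l (𝓝 0) := by
    simpa using (hd.div_atTop hs).abs
  have hb : Tendsto (fun a => d a ^ 2 * (|d a / √(k a)| * Real.exp |d a / √(k a)|)) l (𝓝 0) := by
    have := (hd.pow 2).mul (hx.mul ((Real.continuous_exp.tendsto 0).comp hx))
    simpa using this
  have hmain : Tendsto (fun a => (k a : ℂ) * (Complex.exp ((d a / √(k a) : ℝ) * Complex.I) - 1
      - (d a / √(k a) : ℝ) * Complex.I) + (d a ^ 2 / 2 : ℝ)) l (𝓝 0) := by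
    refine squeeze_zero_norm' ?_ hb
    filter_upwards [hk.eventually_gt_atTop 0] with a ha
    set x : ℝ := d a / √(k a) with hxdef
    have hka : (0 : ℝ) < k a := by exact_mod_cast ha
    have hkx : (k a : ℝ) * x ^ 2 = d a ^ 2 := by
      rw [hxdef, div_pow, Real.sq_sqrt hka.le]; field_simp
    have hkx' : (k a : ℂ) * (x : ℂ) ^ 2 = (d a : ℂ) ^ 2 := by exact_mod_cast hkx
    have h3 := Complex.norm_exp_sub_sum_le_norm_mul_exp ((x : ℂ) * Complex.I) 3
    have e : (k a : ℂ) * (Complex.exp (x * Complex.I) - 1 - x * Complex.I) + (d a ^ 2 / 2 : ℝ)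
        = k a * (Complex.exp (x * Complex.I)
          - ∑ m ∈ Finset.range 3, (x * Complex.I) ^ m / m.factorial) := by
      simp only [Finset.sum_range_succ, Finset.sum_range_zero, Nat.factorial]
      push_cast
      rw [mul_pow (x : ℂ) Complex.I 2, Complex.I_sq, ← hkx']
      ring
    have hn : ‖(x : ℂ) * Complex.I‖ = |x| := by simp
    rw [hn] at h3
    rw [e, norm_mul, Complex.norm_natCast, ← hkx]
    calc (k a : ℝ) * _ ≤ k a * (|x| ^ 3 * Real.exp |x|) := by gcongr
      _ = k a * x ^ 2 * (|x| * Real.exp |x|) := by rw [← sq_abs x]; ring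
  have h2 : Tendsto (fun a => ((d a ^ 2 / 2 : ℝ) : ℂ)) l (𝓝 ((d₀ ^ 2 / 2 : ℝ) : ℂ)) :=
    (Complex.continuous_ofReal.tendsto _).comp ((hd.pow 2).div_const 2)
  simpa using hmain.sub h2

lemma tendsto_sum_mul_exp_pow {α ι : Type*} [Fintype ι] {l : Filter α} {k : α → ℕ}
    {u : ι → ℝ} (hu : ∑ j, u j = 1) {d : α → ι → ℝ} {d₀ : ι → ℝ}
    (hk : Tendsto k l atTop) (hd : ∀ j, Tendsto (fun a => d a j) l (𝓝 (d₀ j)))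
    (hmean : ∀ a, ∑ j, u j * d a j = 0) :
    Tendsto (fun a => (∑ j, (u j : ℂ) * Complex.exp ((d a j / √(k a) : ℝ) * Complex.I)) ^ k a) l
      (𝓝 (Complex.exp (-((∑ j, u j * d₀ j ^ 2) / 2 : ℝ)))) := by
  have hu' : ∑ j, (u j : ℂ) = 1 := by exact_mod_cast hu
  have key : ∀ a, ∑ j, (u j : ℂ) * Complex.exp ((d a j / √(k a) : ℝ) * Complex.I)
      = 1 + ∑ j, (u j : ℂ) * (Complex.exp ((d a j / √(k a) : ℝ) * Complex.I) - 1
        - (d a j / √(k a) : ℝ) * Complex.I) := by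
    intro a
    have h0 : ∑ j, (u j : ℂ) * ((d a j / √(k a) : ℝ) * Complex.I) = 0 := by
      have : ∑ j, (u j : ℂ) * ((d a j / √(k a) : ℝ) * Complex.I)
          = ((∑ j, u j * d a j : ℝ) : ℂ) * ((√(k a))⁻¹ * Complex.I) := by
        push_cast
        rw [Finset.sum_mul]
        exact Finset.sum_congr rfl fun j _ => by ring
      rw [this, hmean a]; simp
    simp only [mul_sub, Finset.sum_sub_distrib, mul_one, hu', h0]
    ring
  simp_rw [key]
  refine tendsto_one_add_pow_exp_of_tendsto_mul hk ?_
  have := tendsto_finsetSum Finset.univ fun j (_ : j ∈ Finset.univ) =>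
    (tendsto_mul_exp_sub_one_sub_self hk (hd j)).const_mul (u j : ℂ)
  convert this using 2 with a
  · rw [Finset.mul_sum]
    exact Finset.sum_congr rfl fun j _ => by ring
  · push_cast
    rw [Finset.sum_div, ← Finset.sum_neg_distrib]
    exact Finset.sum_congr rfl fun j _ => by ring

lemma multinomialPMF_nonneg {ι : Type*} [Fintype ι] {n : ℕ} {u : ι → ℝ} (hu : ∀ j, 0 ≤ u j)
    (x : ι → ℕ) : 0 ≤ multinomialPMF n u x := by
  unfold multinomialPMF
  split_ifs
  · have := Finset.prod_nonneg fun j (_ : j ∈ Finset.univ) => pow_nonneg (hu j) (x j)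
    positivity
  · rfl

lemma sum_multinomialPMF_mul_prod_pow {ι : Type*} [Fintype ι] [DecidableEq ι] (n : ℕ) (u : ι → ℝ)
    (z : ι → ℂ) :
    ∑ x ∈ Finset.piAntidiag Finset.univ n, (multinomialPMF n u x : ℂ) * ∏ j, z j ^ x j
      = (∑ j, (u j : ℂ) * z j) ^ n := by
  rw [Finset.sum_pow_eq_sum_piAntidiag]
  refine Finset.sum_congr rfl fun x hx => ?_
  have hx' : ∑ j, x j = n := (Finset.mem_piAntidiag.1 hx).1
  have hm : (Nat.multinomial Finset.univ x : ℂ) = (n.factorial : ℂ) / ∏ j, ((x j).factorial : ℂ) := by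
    rw [eq_div_iff (Finset.prod_ne_zero_iff.2 fun j _ =>
      Nat.cast_ne_zero.2 (Nat.factorial_ne_zero _)), mul_comm]
    have := Nat.multinomial_spec Finset.univ x
    rw [hx'] at this
    exact_mod_cast this
  simp only [multinomialPMF, hx', if_true, mul_pow, Finset.prod_mul_distrib, hm]
  push_cast
  ring

lemma multinomialPMF_eq_zero {ι : Type*} [Fintype ι] [DecidableEq ι] {n : ℕ} {u : ι → ℝ} {x : ι → ℕ}
    (hx : x ∉ Finset.piAntidiag Finset.univ n) : multinomialPMF n u x = 0 := by
  rw [multinomialPMF, if_neg]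
  simpa [Finset.mem_piAntidiag] using hx

lemma sum_multinomialPMF {ι : Type*} [Fintype ι] [DecidableEq ι] (n : ℕ) {u : ι → ℝ}
    (hu : ∑ j, u j = 1) :
    ∑ x ∈ Finset.piAntidiag Finset.univ n, multinomialPMF n u x = 1 := by
  have h := sum_multinomialPMF_mul_prod_pow n u 1
  have hu' : ∑ j, (u j : ℂ) = 1 := by exact_mod_cast hu
  simp only [Pi.one_apply, one_pow, Finset.prod_const_one, mul_one, hu'] at h
  exact_mod_cast h

lemma tendsto_sum_of_tendsto_charFun {E X : Type*} [NormedAddCommGroup E] [InnerProductSpace ℝ E]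
    [FiniteDimensional ℝ E] [MeasurableSpace E] [BorelSpace E] {S : ℕ → Finset X}
    {w : ℕ → X → ℝ} {g : ℕ → X → E} (hw0 : ∀ m x, 0 ≤ w m x) (hw1 : ∀ m, ∑ x ∈ S m, w m x = 1)
    (ν : Measure E) [IsProbabilityMeasure ν]
    (h : ∀ t, Tendsto (fun m => ∑ x ∈ S m, (w m x : ℂ) * Complex.exp (inner ℝ (g m x) t * Complex.I))
      atTop (𝓝 (charFun ν t))) (f : BoundedContinuousFunction E ℝ) :
    Tendsto (fun m => ∑ x ∈ S m, w m x * f (g m x)) atTop (𝓝 (∫ y, f y ∂ν)) := by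
  let μ : ℕ → Measure E := fun m => ∑ x ∈ S m, ENNReal.ofReal (w m x) • Measure.dirac (g m x)
  have hμ : ∀ m, IsProbabilityMeasure (μ m) := fun m => ⟨by
    simp only [μ, Measure.coe_finsetSum, Finset.sum_apply, Measure.smul_apply, measure_univ,
      smul_eq_mul, mul_one]
    rw [← ENNReal.ofReal_sum_of_nonneg fun x _ => hw0 m x, hw1, ENNReal.ofReal_one]⟩
  have hint : ∀ m {F : Type} [NormedAddCommGroup F] [NormedSpace ℝ F] [CompleteSpace F] (φ : E → F),
      ∫ y, φ y ∂(μ m) = ∑ x ∈ S m, w m x • φ (g m x) := by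
    intro m F _ _ _ φ
    rw [integral_finsetSum_measure fun x _ =>
      (integrable_dirac (by simp)).smul_measure ENNReal.ofReal_ne_top]
    refine Finset.sum_congr rfl fun x _ => ?_
    rw [integral_smul_measure, integral_dirac, ENNReal.toReal_ofReal (hw0 m x)]
  let P : ℕ → ProbabilityMeasure E := fun m => ⟨μ m, hμ m⟩
  let Q : ProbabilityMeasure E := ⟨ν, inferInstance⟩
  have hconv : Tendsto P atTop (𝓝 Q) := by
    refine ProbabilityMeasure.tendsto_iff_tendsto_charFun.2 fun t => ?_
    refine (h t).congr fun m => ?_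
    simp [P, charFun_apply, hint]
  refine (ProbabilityMeasure.tendsto_iff_forall_integral_tendsto.1 hconv f).congr fun m => ?_
  simp [P, hint]

lemma isCenteredGaussianWithCov_multivariateGaussian {N : ℕ} {C : Matrix (Fin N) (Fin N) ℝ}
    (hC : C.PosSemidef) :
    IsCenteredGaussianWithCov ((multivariateGaussian 0 C).map WithLp.ofLp) C := by
  have hm : Measurable (WithLp.ofLp : EuclideanSpace ℝ (Fin N) → Fin N → ℝ) := by fun_prop
  refine ⟨Measure.isProbabilityMeasure_map hm.aemeasurable, fun t => ?_⟩
  rw [Measure.map_map (by fun_prop) hm]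
  have hL : ((fun y : Fin N → ℝ => ∑ j, t j * y j) ∘ WithLp.ofLp)
      = innerSL ℝ (WithLp.toLp 2 t : EuclideanSpace ℝ (Fin N)) := by
    ext y
    simp [PiLp.inner_apply, mul_comm]
  rw [hL, IsGaussian.map_eq_gaussianReal, ContinuousLinearMap.integral_comp_id_comm
    IsGaussian.integrable_id, integral_id_multivariateGaussian, map_zero]
  congr 2
  have := covarianceBilin_multivariateGaussian (μ := 0) hC (WithLp.toLp 2 t) (WithLp.toLp 2 t)
  rw [covarianceBilin_self IsGaussian.memLp_two_id] at this
  refine this.trans ?_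
  simp only [dotProduct, mulVec, Finset.mul_sum, mul_assoc]

lemma dotProduct_Vmat_mulVec {ι : Type*} [Fintype ι] [DecidableEq ι] {u : ι → ℝ}
    (hu : ∑ j, u j = 1) (y : ι → ℝ) :
    y ⬝ᵥ Vmat u *ᵥ y = ∑ j, u j * (y j - ∑ k, u k * y k) ^ 2 := by
  set c := ∑ k, u k * y k with hc
  have h1 : y ⬝ᵥ Vmat u *ᵥ y = ∑ j, u j * y j ^ 2 - c ^ 2 := by
    rw [Vmat, sub_mulVec, dotProduct_sub, vecMulVec_mulVec]
    have : u ⬝ᵥ y = c := rfl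
    rw [this]
    congr 1
    · exact Finset.sum_congr rfl fun j _ => by rw [mulVec_diagonal]; ring
    · simp only [dotProduct, Pi.smul_apply, MulOpposite.smul_eq_mul_unop, MulOpposite.unop_op]
      rw [sq]; nth_rw 3 [hc]; rw [Finset.sum_mul]
      exact Finset.sum_congr rfl fun j _ => by ring
  have h2 : ∑ j, u j * (y j - c) ^ 2 = ∑ j, u j * y j ^ 2 - 2 * c * ∑ j, u j * y j
      + c ^ 2 * ∑ j, u j := by
    simp only [Finset.mul_sum, ← Finset.sum_sub_distrib, ← Finset.sum_add_distrib]
    exact Finset.sum_congr rfl fun j _ => by ring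
  rw [h1, h2, hu, ← hc]; ring

lemma Vmat_posSemidef {ι : Type*} [Fintype ι] [DecidableEq ι] {u : ι → ℝ} (hu0 : ∀ j, 0 ≤ u j)
    (hu : ∑ j, u j = 1) : (Vmat u).PosSemidef := by
  refine .of_dotProduct_mulVec_nonneg ?_ fun y => ?_
  · ext i j
    by_cases h : i = j <;> simp [Vmat, vecMulVec_apply, h, eq_comm, mul_comm]
  · rw [star_trivial, dotProduct_Vmat_mulVec hu]
    exact Finset.sum_nonneg fun j _ => mul_nonneg (hu0 j) (sq_nonneg _)

lemma isUnit_transpose_mul_self_iff {ι κ : Type*} [Fintype ι] [Fintype κ] [DecidableEq κ]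
    (A : Matrix ι κ ℝ) : IsUnit (Aᵀ * A) ↔ ∀ v, A *ᵥ v = 0 → v = 0 := by
  rw [← mulVec_injective_iff_isUnit]
  have : Function.Injective (Aᵀ * A).mulVec ↔ ∀ v, (Aᵀ * A) *ᵥ v = 0 → v = 0 :=
    injective_iff_map_eq_zero (Aᵀ * A).mulVecLin
  rw [this]
  have h2 (v) : (Aᵀ * A) *ᵥ v = 0 ↔ A *ᵥ v = 0 := by
    simpa using conjTranspose_mul_self_mulVec_eq_zero A v
  simp only [h2]

lemma isUnit_transpose_mul_self_of_rank {ι κ : Type*} [Fintype ι] [Fintype κ] [DecidableEq κ]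
    {A : Matrix ι κ ℝ} (h : A.rank = Fintype.card κ) : IsUnit (Aᵀ * A) := by
  rw [← rank_transpose_mul_self, Matrix.rank] at h
  rw [← mulVec_surjective_iff_isUnit]
  have := Submodule.eq_top_of_finrank_eq (h.trans (Module.finrank_pi ℝ).symm)
  exact LinearMap.range_eq_top.1 this

lemma tendsto_matrix_inv {α κ : Type*} [Fintype κ] [DecidableEq κ] {l : Filter α}
    {M : α → Matrix κ κ ℝ} {M₀ : Matrix κ κ ℝ} (hM : Tendsto M l (𝓝 M₀)) (h₀ : IsUnit M₀) :
    Tendsto (fun a => (M a)⁻¹) l (𝓝 M₀⁻¹) := by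
  simp only [Matrix.inv_def, Ring.inverse_eq_inv']
  have hdet : M₀.det ≠ 0 := ((isUnit_iff_isUnit_det M₀).1 h₀).ne_zero
  exact (((continuous_id.matrix_det.tendsto M₀).comp hM).inv₀ hdet).smul
    ((continuous_id.matrix_adjugate.tendsto M₀).comp hM)

lemma tendsto_matrix_mul {α ι κ τ : Type*} [Fintype κ] {l : Filter α} {M : α → Matrix ι κ ℝ}
    {P : α → Matrix κ τ ℝ} {M₀ : Matrix ι κ ℝ} {P₀ : Matrix κ τ ℝ} (hM : Tendsto M l (𝓝 M₀))
    (hP : Tendsto P l (𝓝 P₀)) : Tendsto (fun a => M a * P a) l (𝓝 (M₀ * P₀)) := by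
  have hc : Continuous fun q : Matrix ι κ ℝ × Matrix κ τ ℝ => q.1 * q.2 :=
    continuous_fst.matrix_mul continuous_snd
  exact (hc.tendsto (M₀, P₀)).comp (hM.prodMk_nhds hP)

lemma tendsto_inv_transpose_mul_self_mul_transpose {α ι κ : Type*} [Fintype ι] [Fintype κ]
    [DecidableEq κ] {l : Filter α} {M : α → Matrix ι κ ℝ} {M₀ : Matrix ι κ ℝ}
    (hM : Tendsto M l (𝓝 M₀)) (h₀ : IsUnit (M₀ᵀ * M₀)) :
    Tendsto (fun a => ((M a)ᵀ * M a)⁻¹ * (M a)ᵀ) l (𝓝 ((M₀ᵀ * M₀)⁻¹ * M₀ᵀ)) := by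
  have hT : Tendsto (fun a => (M a)ᵀ) l (𝓝 M₀ᵀ) :=
    (continuous_id.matrix_transpose.tendsto M₀).comp hM
  exact tendsto_matrix_mul (tendsto_matrix_inv (tendsto_matrix_mul hT hM) h₀) hT

lemma sum_prod_multinomialPMF_mul_exp {L : ℕ} {K : Fin L → ℕ} (n : Fin L → ℕ)
    (u d : ∀ i, Fin (K i) → ℝ) :
    ∑ x ∈ Fintype.piFinset fun i => Finset.piAntidiag (Finset.univ : Finset (Fin (K i))) (n i),
      ((∏ i, multinomialPMF (n i) (u i) (x i) : ℝ) : ℂ)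
        * Complex.exp ((∑ i, ∑ k, (x i k : ℝ) * d i k : ℝ) * Complex.I)
      = ∏ i, (∑ k, (u i k : ℂ) * Complex.exp ((d i k : ℝ) * Complex.I)) ^ n i := by
  simp only [← sum_multinomialPMF_mul_prod_pow, Finset.prod_univ_sum]
  refine Finset.sum_congr rfl fun x _ => ?_
  rw [Finset.prod_mul_distrib]
  push_cast
  simp only [Finset.sum_mul, Complex.exp_sum, ← Complex.exp_nat_mul, mul_assoc]

/-- central limit theorem for the stacked-multinomial estimator
`p̂ = (1/n)(A'A)⁻¹ A' X̄` of Lemma 1. If `α_i = n_i/n → α̃_i > 0` with `Σ_i α̃_i = 1` and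
all `n_i → ∞`, then `√n (p̂ − p)` converges in distribution (i.e. the expectations of
every bounded continuous function converge) to a centered multivariate Gaussian `G` with
covariance `(Ã'Ã)⁻¹ (Σ_i α̃_i³ A_i' V(A_i p) A_i) (Ã'Ã)⁻¹`, where `Ã` stacks the blocks
`α̃_i A_i`. -/
theorem statement3 (L N : ℕ) (K : Fin L → ℕ)
    (Ai : ∀ i : Fin L, Matrix (Fin (K i)) (Fin N) ℝ)
    (hAi0 : ∀ i k j, 0 ≤ Ai i k j) (hAi1 : ∀ i j, ∑ k, Ai i k j = 1)
    (p : Fin N → ℝ) (hp0 : ∀ j, 0 ≤ p j) (hp1 : ∑ j, p j = 1)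
    (nn : ℕ → Fin L → ℕ) (n : ℕ → ℕ) (hn : ∀ m, n m = ∑ i, nn m i)
    (αt : Fin L → ℝ) (hαt0 : ∀ i, 0 < αt i) (hαt1 : ∑ i, αt i = 1)
    (hαconv : ∀ i, Tendsto (fun m => (nn m i : ℝ) / (n m : ℝ)) atTop (𝓝 (αt i)))
    (hni : ∀ i, Tendsto (fun m => nn m i) atTop atTop)
    (A : ℕ → Matrix ((i : Fin L) × Fin (K i)) (Fin N) ℝ)
    (hA : ∀ m i k j, A m ⟨i, k⟩ j = ((nn m i : ℝ) / (n m : ℝ)) * Ai i k j)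
    (hrank : ∀ m, (A m).rank = N)
    (At : Matrix ((i : Fin L) × Fin (K i)) (Fin N) ℝ)
    (hAt : ∀ i k j, At ⟨i, k⟩ j = αt i * Ai i k j)
    (phat : ℕ → ((i : Fin L) → Fin (K i) → ℕ) → Fin N → ℝ)
    (hphat : ∀ m x, phat m x =
      (1 / (n m : ℝ)) • (((A m)ᵀ * A m)⁻¹ * (A m)ᵀ).mulVec fun ik => (x ik.1 ik.2 : ℝ)) :
    ∃ μG : Measure (Fin N → ℝ),
      IsCenteredGaussianWithCov μG
        ((Atᵀ * At)⁻¹ *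
          (∑ i, (αt i) ^ 3 • ((Ai i)ᵀ * Vmat ((Ai i).mulVec p) * Ai i)) *
          (Atᵀ * At)⁻¹) ∧
      ∀ f : BoundedContinuousFunction (Fin N → ℝ) ℝ,
        Tendsto
          (fun m => ∑' x : (i : Fin L) → Fin (K i) → ℕ,
            (∏ i, multinomialPMF (nn m i) ((Ai i).mulVec p) (x i)) *
              f (fun j => Real.sqrt (n m) * (phat m x j - p j)))
          atTop (𝓝 (∫ y, f y ∂μG)) := by
  classical
  set u : ∀ i, Fin (K i) → ℝ := fun i => Ai i *ᵥ p with hu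
  have hu0 : ∀ i k, 0 ≤ u i k := fun i k =>
    show 0 ≤ ∑ j, Ai i k j * p j from Finset.sum_nonneg fun j _ => mul_nonneg (hAi0 i k j) (hp0 j)
  have hu1 : ∀ i, ∑ k, u i k = 1 := by
    intro i
    simp only [hu, mulVec, dotProduct]
    rw [Finset.sum_comm]
    simp only [← Finset.sum_mul, hAi1, one_mul, hp1]
  have hAmul : ∀ m i k (v : Fin N → ℝ),
      (A m *ᵥ v) ⟨i, k⟩ = ((nn m i : ℝ) / (n m : ℝ)) * (Ai i *ᵥ v) k := by
    intro m i k v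
    simp only [mulVec, dotProduct, hA, Finset.mul_sum, mul_assoc]
  have hAtmul : ∀ i k (v : Fin N → ℝ), (At *ᵥ v) ⟨i, k⟩ = αt i * (Ai i *ᵥ v) k := by
    intro i k v
    simp only [mulVec, dotProduct, hAt, Finset.mul_sum, mul_assoc]
  have hAunit : ∀ m, IsUnit ((A m)ᵀ * A m) := fun m =>
    isUnit_transpose_mul_self_of_rank (by simpa using hrank m)
  have hAtunit : IsUnit (Atᵀ * At) := by
    refine (isUnit_transpose_mul_self_iff At).2 fun v hv => ?_
    refine (isUnit_transpose_mul_self_iff (A 0)).1 (hAunit 0) v ?_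
    ext ⟨i, k⟩
    have h := congrFun hv ⟨i, k⟩
    rw [hAtmul] at h
    rw [hAmul, (mul_eq_zero.1 h).resolve_left (hαt0 i).ne']
    simp
  have hAlim : Tendsto A atTop (𝓝 At) := by
    refine tendsto_pi_nhds.2 fun ⟨i, k⟩ => tendsto_pi_nhds.2 fun j => ?_
    simp only [hA, hAt]
    exact (hαconv i).mul_const _
  have hBlim : Tendsto (fun m => ((A m)ᵀ * A m)⁻¹ * (A m)ᵀ) atTop
      (𝓝 ((Atᵀ * At)⁻¹ * Atᵀ)) :=
    tendsto_inv_transpose_mul_self_mul_transpose hAlim hAtunit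
  set C := (Atᵀ * At)⁻¹ * (∑ i, (αt i) ^ 3 • ((Ai i)ᵀ * Vmat (u i) * Ai i)) * (Atᵀ * At)⁻¹
    with hCdef
  have hBsymm : ((Atᵀ * At)⁻¹)ᵀ = (Atᵀ * At)⁻¹ := by
    rw [transpose_nonsing_inv, transpose_mul, transpose_transpose]
  have hC : C.PosSemidef := by
    have hM : (∑ i, (αt i) ^ 3 • ((Ai i)ᵀ * Vmat (u i) * Ai i)).PosSemidef :=
      posSemidef_sum _ fun i _ => ((Vmat_posSemidef (hu0 i) (hu1 i)).conjTranspose_mul_mul_same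
        (Ai i)).smul (pow_nonneg (hαt0 i).le 3)
    have := hM.conjTranspose_mul_mul_same (Atᵀ * At)⁻¹
    rwa [conjTranspose_eq_transpose_of_trivial, hBsymm] at this
  have hn0 : ∀ᶠ m in atTop, n m ≠ 0 := by
    have hL : Nonempty (Fin L) := by
      by_contra h
      rw [not_nonempty_iff] at h
      simp at hαt1
    obtain ⟨i⟩ := hL
    filter_upwards [(hni i).eventually_ne_atTop 0] with m hm
    rw [hn, ne_eq, Finset.sum_eq_zero_iff]
    exact fun h => hm (h i (Finset.mem_univ i))
  refine ⟨_, isCenteredGaussianWithCov_multivariateGaussian hC, fun f => ?_⟩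
  let S : ℕ → Finset (∀ i, Fin (K i) → ℕ) := fun m =>
    Fintype.piFinset fun i => Finset.piAntidiag (Finset.univ : Finset (Fin (K i))) (nn m i)
  let g : ℕ → (∀ i, Fin (K i) → ℕ) → EuclideanSpace ℝ (Fin N) := fun m x =>
    WithLp.toLp 2 fun j => Real.sqrt (n m) * (phat m x j - p j)
  have hofLp : Continuous (WithLp.ofLp : EuclideanSpace ℝ (Fin N) → Fin N → ℝ) := by fun_prop
  rw [integral_map hofLp.measurable.aemeasurable
    f.continuous.measurable.aestronglyMeasurable]
  refine (tendsto_sum_of_tendsto_charFun (S := S) (g := g)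
    (w := fun m x => ∏ i, multinomialPMF (nn m i) (u i) (x i))
    (fun m x => Finset.prod_nonneg fun i _ => multinomialPMF_nonneg (hu0 i) _) (fun m => ?_)
    (multivariateGaussian 0 C) (fun t => ?_) (f.compContinuous ⟨_, hofLp⟩)).congr fun m => ?_
  · rw [← Finset.prod_univ_sum]
    exact Finset.prod_eq_one fun i _ => sum_multinomialPMF _ (hu1 i)
  · let v : ℕ → ((i : Fin L) × Fin (K i)) → ℝ := fun m => t.ofLp ᵥ* (((A m)ᵀ * A m)⁻¹ * (A m)ᵀ)
    let v₀ : ((i : Fin L) × Fin (K i)) → ℝ := t.ofLp ᵥ* ((Atᵀ * At)⁻¹ * Atᵀ)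
    let d : ℕ → ∀ i, Fin (K i) → ℝ := fun m i k =>
      √((nn m i : ℝ) / n m) * (v m ⟨i, k⟩ - ∑ l, u i l * v m ⟨i, l⟩)
    let d₀ : ∀ i, Fin (K i) → ℝ := fun i k =>
      √(αt i) * (v₀ ⟨i, k⟩ - ∑ l, u i l * v₀ ⟨i, l⟩)
    have hv : Tendsto v atTop (𝓝 v₀) := by
      have hc : Continuous fun M : Matrix (Fin N) ((i : Fin L) × Fin (K i)) ℝ => t.ofLp ᵥ* M := by
        fun_prop
      exact (hc.tendsto _).comp hBlim
    have hv' : ∀ ik, Tendsto (fun m => v m ik) atTop (𝓝 (v₀ ik)) := tendsto_pi_nhds.1 hv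
    have hd : ∀ i k, Tendsto (fun m => d m i k) atTop (𝓝 (d₀ i k)) := fun i k =>
      ((Real.continuous_sqrt.tendsto _).comp (hαconv i)).mul
        ((hv' _).sub (tendsto_finsetSum _ fun l _ => (hv' _).const_mul _))
    have hmean : ∀ m i, ∑ k, u i k * d m i k = 0 := by
      intro m i
      simp only [d, mul_sub, mul_left_comm (u i _), Finset.sum_sub_distrib, ← Finset.mul_sum,
        ← Finset.sum_mul, hu1, one_mul, sub_self]
    have hlim := tendsto_finsetProd Finset.univ fun i (_ : i ∈ Finset.univ) =>
      tendsto_sum_mul_exp_pow (hu1 i) (hni i) (hd i) fun m => hmean m i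
    have hlimit : ∏ i, Complex.exp (-((∑ k, u i k * d₀ i k ^ 2) / 2 : ℝ))
        = charFun (multivariateGaussian 0 C) t := by
      set y := (Atᵀ * At)⁻¹ *ᵥ t.ofLp with hy
      have hv₀ : ∀ i k, v₀ ⟨i, k⟩ = αt i * (Ai i *ᵥ y) k := by
        intro i k
        simp only [v₀]
        rw [← vecMul_vecMul, vecMul_transpose, hAtmul, ← mulVec_transpose, hBsymm]
      have hquad : t.ofLp ⬝ᵥ C *ᵥ t.ofLp = ∑ i, ∑ k, u i k * d₀ i k ^ 2 := by
        rw [hCdef, ← mulVec_mulVec, ← mulVec_mulVec, dotProduct_mulVec, ← mulVec_transpose, hBsymm,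
          ← hy, sum_mulVec, dotProduct_sum]
        refine Finset.sum_congr rfl fun i _ => ?_
        rw [smul_mulVec, dotProduct_smul, ← mulVec_mulVec, ← mulVec_mulVec, dotProduct_mulVec,
          vecMul_transpose, dotProduct_Vmat_mulVec (hu1 i), smul_eq_mul, Finset.mul_sum]
        refine Finset.sum_congr rfl fun k _ => ?_
        simp only [d₀, hv₀, mul_left_comm (u i _), ← Finset.mul_sum, ← mul_sub, mul_pow,
          Real.sq_sqrt (hαt0 i).le]
        ring
      rw [charFun_multivariateGaussian hC, hquad, ← Complex.exp_sum]
      congr 1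
      push_cast
      simp [Finset.sum_div]
    rw [← hlimit]
    refine hlim.congr' ?_
    filter_upwards [hn0, eventually_all.2 fun i => (hni i).eventually_ne_atTop 0] with m hm hmi
    have hnpos : (0 : ℝ) < n m := by exact_mod_cast Nat.pos_of_ne_zero hm
    rw [← sum_prod_multinomialPMF_mul_exp (nn m) u fun i k => d m i k / √(nn m i)]
    refine Finset.sum_congr rfl fun x hx => ?_
    have hxi : ∀ i, ∑ k, (x i k : ℝ) = nn m i := fun i => by
      have := (Finset.mem_piAntidiag.1 (Fintype.mem_piFinset.1 hx i)).1
      exact_mod_cast this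
    have hphat_dot : t.ofLp ⬝ᵥ phat m x
        = 1 / (n m : ℝ) * ∑ i, ∑ k, v m ⟨i, k⟩ * (x i k : ℝ) := by
      rw [hphat, dotProduct_smul, dotProduct_mulVec, smul_eq_mul, ← Fintype.sum_sigma']
      rfl
    have hp_dot : t.ofLp ⬝ᵥ p
        = 1 / (n m : ℝ) * ∑ i, nn m i * ∑ k, u i k * v m ⟨i, k⟩ := by
      have hinv : (((A m)ᵀ * A m)⁻¹ * (A m)ᵀ) *ᵥ (A m *ᵥ p) = p := by
        rw [mulVec_mulVec, Matrix.mul_assoc,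
          nonsing_inv_mul _ ((isUnit_iff_isUnit_det _).1 (hAunit m)), one_mulVec]
      rw [← hinv, dotProduct_mulVec, dotProduct, Fintype.sum_sigma, Finset.mul_sum]
      refine Finset.sum_congr rfl fun i _ => ?_
      simp only [hAmul, Finset.mul_sum]
      exact Finset.sum_congr rfl fun k _ => by simp only [v, hu]; ring
    have hinner : (inner ℝ (g m x) t : ℝ) = √(n m) * (t.ofLp ⬝ᵥ phat m x - t.ofLp ⬝ᵥ p) := by
      simp only [g, PiLp.inner_apply, dotProduct, ← Finset.sum_sub_distrib, Finset.mul_sum]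
      exact Finset.sum_congr rfl fun j _ => by simp; ring
    have hsum : ∑ i, ∑ k, (x i k : ℝ) * (d m i k / √(nn m i)) = inner ℝ (g m x) t := by
      rw [hinner, hphat_dot, hp_dot, ← mul_sub, ← mul_assoc, ← Finset.sum_sub_distrib,
        Finset.mul_sum]
      refine Finset.sum_congr rfl fun i _ => ?_
      have hnn : (0 : ℝ) < √(nn m i) :=
        Real.sqrt_pos.2 (by exact_mod_cast Nat.pos_of_ne_zero (hmi i))
      have hc : √(n m : ℝ) * (1 / n m) = (√(n m : ℝ))⁻¹ := by
        rw [mul_one_div, Real.sqrt_div_self', one_div]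
      rw [hc, ← hxi i, Finset.sum_mul, ← Finset.sum_sub_distrib, Finset.mul_sum]
      refine Finset.sum_congr rfl fun k _ => ?_
      simp only [d]
      rw [Real.sqrt_div' _ hnpos.le, hxi i]
      field_simp
    rw [hsum]
  · rw [tsum_eq_sum (s := S m)]
    · rfl
    · intro x hx
      simp only [S, Fintype.mem_piFinset, not_forall] at hx
      obtain ⟨i, hi⟩ := hx
      rw [Finset.prod_eq_zero (Finset.mem_univ i) (multinomialPMF_eq_zero hi), zero_mul]
end

section
/- In the pair method with N ≥ 3 parties, the unbiased estimators p̂_i := ((N−1)/(N−2)) Σ_{j ≠ i} û_{{i,j}} − 1/(N−2), with û = X/n and X ~ Mult(n, A p), satisfy Cov[p̂_i, p̂_j] = −(1/n)( (1 − p_i − p_j)/(N−2)^2 + p_i p_j ) for all i ≠ j. -/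
open Matrix

/-- The index type of unordered pairs of distinct parties (the possible responses in
the pair method), realized as two-element subsets of `Fin N`. -/
abbrev PairIdx (N : ℕ) := {s : Finset (Fin N) // s.card = 2}

/-- In the pair method the probability of the response `{i,j}` is
`u_{ij} = (p_i + p_j)/(N−1)`. -/
noncomputable def pairU (N : ℕ) (p : Fin N → ℝ) (s : PairIdx N) : ℝ :=
  (∑ k ∈ s.1, p k) / ((N : ℝ) - 1)

/-- The pair-method estimator `p̂_i = ((N−1)/(N−2)) Σ_{j≠i} û_{{i,j}} − 1/(N−2)`,
where `û = X/n` and the sum runs over all pairs containing `i`. -/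
noncomputable def pairPhat (N : ℕ) (n : ℕ) (x : PairIdx N → ℕ) (i : Fin N) : ℝ :=
  ((N : ℝ) - 1) / ((N : ℝ) - 2) *
      (∑ s : PairIdx N, if i ∈ s.1 then (x s : ℝ) / (n : ℝ) else 0) -
    1 / ((N : ℝ) - 2)

section MultinomialMoments

variable {ι : Type*} [Fintype ι] {n : ℕ} {u : ι → ℝ}

/-- The expectation of `f` under the multinomial distribution `Mult(n, u)`. -/
noncomputable def multinomialExp (n : ℕ) (u : ι → ℝ) (f : (ι → ℕ) → ℝ) : ℝ :=
  ∑' x, multinomialPMF n u x * f x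

theorem finite_setOf_sum_eq (ι : Type*) [Fintype ι] (n : ℕ) :
    {x : ι → ℕ | ∑ i, x i = n}.Finite := by
  refine (Set.Finite.pi' fun _ : ι => Set.finite_Iic n).subset fun x hx i => ?_
  rw [Set.mem_Iic, ← (show ∑ i, x i = n from hx)]
  exact Finset.single_le_sum (fun _ _ => Nat.zero_le _) (Finset.mem_univ i)

theorem summable_multinomialPMF_mul (n : ℕ) (u : ι → ℝ) (f : (ι → ℕ) → ℝ) :
    Summable fun x => multinomialPMF n u x * f x := by
  refine summable_of_hasFiniteSupport ((finite_setOf_sum_eq ι n).subset fun x hx => ?_)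
  by_contra h
  exact hx (by simp [multinomialPMF, show ¬ ∑ i, x i = n from h])

theorem multinomialExp_add (f g : (ι → ℕ) → ℝ) :
    multinomialExp n u (fun x => f x + g x) =
      multinomialExp n u f + multinomialExp n u g := by
  simp only [multinomialExp, mul_add]
  exact (summable_multinomialPMF_mul n u f).tsum_add (summable_multinomialPMF_mul n u g)

theorem multinomialExp_const_mul (c : ℝ) (f : (ι → ℕ) → ℝ) :
    multinomialExp n u (fun x => c * f x) = c * multinomialExp n u f := by
  simp only [multinomialExp, mul_left_comm _ c, tsum_mul_left]

theorem multinomialExp_sum {κ : Type*} (s : Finset κ) (f : κ → (ι → ℕ) → ℝ) :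
    multinomialExp n u (fun x => ∑ k ∈ s, f k x) = ∑ k ∈ s, multinomialExp n u (f k) := by
  simp only [multinomialExp, Finset.mul_sum]
  exact Summable.tsum_finsetSum fun k _ => summable_multinomialPMF_mul n u (f k)

theorem multinomialExp_congr {f g : (ι → ℕ) → ℝ} (h : ∀ x, ∑ i, x i = n → f x = g x) :
    multinomialExp n u f = multinomialExp n u g := by
  refine tsum_congr fun x => ?_
  by_cases hx : ∑ i, x i = n
  · rw [h x hx]
  · simp [multinomialPMF, hx]

variable [DecidableEq ι]

theorem multinomialPMF_succ_add_single (n : ℕ) (u : ι → ℝ) (y : ι → ℕ) (k : ι) :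
    multinomialPMF (n + 1) u (y + Pi.single k 1) * ((y k : ℝ) + 1) =
      (n + 1) * u k * multinomialPMF n u y := by
  have hsum : ∑ i, (y + Pi.single k 1 : ι → ℕ) i = ∑ i, y i + 1 := by
    simp [Finset.sum_add_distrib]
  have hfact : ∏ i, (((y + Pi.single k 1 : ι → ℕ) i).factorial : ℝ) =
      (∏ i, ((y i).factorial : ℝ)) * (y k + 1) := by
    have h (i : ι) : (((y + Pi.single k 1 : ι → ℕ) i).factorial : ℝ) =
        ((y i).factorial : ℝ) * if i = k then (y k : ℝ) + 1 else 1 := by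
      rcases eq_or_ne i k with rfl | hik
      · simp [Nat.factorial_succ, mul_comm]
      · simp [hik]
    simp only [h, Finset.prod_mul_distrib, Finset.prod_ite_eq', Finset.mem_univ, if_true]
  have hpow : ∏ i, u i ^ (y + Pi.single k 1 : ι → ℕ) i = (∏ i, u i ^ y i) * u k := by
    have h (i : ι) : u i ^ (y + Pi.single k 1 : ι → ℕ) i = u i ^ y i * if i = k then u k else 1 := by
      rcases eq_or_ne i k with rfl | hik
      · simp [pow_succ]
      · simp [hik]
    simp only [h, Finset.prod_mul_distrib, Finset.prod_ite_eq', Finset.mem_univ, if_true]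
  have hne : ∏ i, ((y i).factorial : ℝ) ≠ 0 :=
    Finset.prod_ne_zero_iff.mpr fun i _ => by positivity
  have hk : (y k : ℝ) + 1 ≠ 0 := by positivity
  simp only [multinomialPMF, hsum, add_left_inj, hfact, hpow]
  split_ifs
  · rw [Nat.factorial_succ]
    push_cast
    field_simp
  · simp

/-- Size-biasing a coordinate of a multinomial vector shifts that coordinate by one. -/
theorem multinomialExp_succ_coord_mul (n : ℕ) (u : ι → ℝ) (k : ι) (f : (ι → ℕ) → ℝ) :
    multinomialExp (n + 1) u (fun x => (x k : ℝ) * f x) =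
      (n + 1) * u k * multinomialExp n u (fun y => f (y + Pi.single k 1)) := by
  have hinj : Function.Injective fun y : ι → ℕ => y + Pi.single k 1 := add_left_injective _
  rw [multinomialExp, multinomialExp, ← tsum_mul_left, ← hinj.tsum_eq]
  · refine tsum_congr fun y => ?_
    rw [← mul_assoc ((n + 1 : ℝ) * u k), ← multinomialPMF_succ_add_single]
    simp [mul_assoc]
  · intro x hx
    have hxk : x k ≠ 0 := fun h => hx (by simp [h])
    refine ⟨x - Pi.single k 1, funext fun i => ?_⟩
    rcases eq_or_ne i k with rfl | hik
    · simp only [Pi.add_apply, Pi.sub_apply, Pi.single_eq_same]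
      omega
    · simp [hik]

theorem multinomialExp_one (hu : ∑ i, u i = 1) (n : ℕ) :
    multinomialExp n u (fun _ => 1) = 1 := by
  induction n with
  | zero =>
    rw [multinomialExp, tsum_eq_single 0]
    · simp [multinomialPMF]
    · intro x hx
      have : ¬ ∑ i, x i = 0 := fun h => hx (funext fun i => by
        simpa using (Finset.sum_eq_zero_iff.mp h) i (Finset.mem_univ i))
      simp [multinomialPMF, this]
  | succ n ih =>
    have hn : (n : ℝ) + 1 ≠ 0 := by positivity
    have h : multinomialExp (n + 1) u (fun x => ∑ k, (x k : ℝ) * 1) = n + 1 := by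
      rw [multinomialExp_sum]
      simp only [multinomialExp_succ_coord_mul n u _ fun _ => 1, ih]
      simp only [mul_one, ← Finset.mul_sum, hu]
    rw [multinomialExp_congr (g := fun _ => ((n : ℝ) + 1) * 1), multinomialExp_const_mul] at h
    · exact mul_left_cancel₀ hn (h.trans (mul_one _).symm)
    · intro x hx
      simp only [mul_one]
      exact_mod_cast hx

theorem multinomialExp_linear (hu : ∑ i, u i = 1) (n : ℕ) (a : ι → ℝ) :
    multinomialExp n u (fun x => ∑ k, a k * x k) = n * ∑ k, a k * u k := by
  cases n with
  | zero =>
    rw [multinomialExp_congr (g := fun _ => 0 * 1), multinomialExp_const_mul]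
    · simp
    · intro x hx
      have hx' : ∀ i, x i = 0 := fun i =>
        (Finset.sum_eq_zero_iff.mp hx) i (Finset.mem_univ i)
      simp [hx']
  | succ n =>
    have h (k : ι) : multinomialExp (n + 1) u (fun x => (x k : ℝ)) = (n + 1) * u k := by
      simpa [multinomialExp_one hu] using multinomialExp_succ_coord_mul n u k (fun _ => 1)
    simp only [multinomialExp_sum, multinomialExp_const_mul, h, Finset.mul_sum]
    push_cast
    exact Finset.sum_congr rfl fun k _ => by ring

theorem multinomialExp_linear_mul_linear (hu : ∑ i, u i = 1) (n : ℕ) (a b : ι → ℝ) :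
    multinomialExp (n + 1) u (fun x => (∑ k, a k * x k) * ∑ k, b k * x k) =
      (n + 1) * (n * (∑ k, a k * u k) * (∑ k, b k * u k) + ∑ k, a k * b k * u k) := by
  have hshift (k : ι) (y : ι → ℕ) :
      ∑ l, b l * (((y + Pi.single k 1 : ι → ℕ) l : ℕ) : ℝ) = (∑ l, b l * y l) + b k * 1 := by
    simp [mul_add, Finset.sum_add_distrib, Pi.single_apply]
  simp only [Finset.sum_mul _ _ (∑ k, b k * _), mul_assoc (a _)]
  simp only [multinomialExp_sum, multinomialExp_const_mul, multinomialExp_succ_coord_mul, hshift,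
    multinomialExp_add, multinomialExp_linear hu, multinomialExp_one hu]
  trans ∑ k, ((n + 1) * (n * ∑ l, b l * u l) * (a k * u k) + (n + 1) * (a k * b k * u k))
  · exact Finset.sum_congr rfl fun k _ => by ring
  · rw [Finset.sum_add_distrib, ← Finset.mul_sum, ← Finset.mul_sum]
    ring_nf

/-- The covariance of two linear statistics of a multinomial vector. -/
theorem multinomialExp_covariance (hu : ∑ i, u i = 1) (hn : 0 < n) (a b : ι → ℝ) :
    multinomialExp n u (fun x => (∑ k, a k * x k - n * ∑ k, a k * u k) *
        (∑ k, b k * x k - n * ∑ k, b k * u k)) =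
      n * (∑ k, a k * b k * u k - (∑ k, a k * u k) * ∑ k, b k * u k) := by
  obtain ⟨m, rfl⟩ := Nat.exists_eq_succ_of_ne_zero hn.ne'
  set α := ∑ k, a k * u k with hα
  set β := ∑ k, b k * u k with hβ
  have h : (fun x : ι → ℕ => (∑ k, a k * x k - (m.succ : ℝ) * α) *
        (∑ k, b k * x k - (m.succ : ℝ) * β)) = fun x =>
      (∑ k, a k * x k) * (∑ k, b k * x k) + (-(m.succ * β) * ∑ k, a k * x k +
        (-(m.succ * α) * ∑ k, b k * x k + (m.succ * α * (m.succ * β)) * 1)) := by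
    ext x
    ring
  rw [h, multinomialExp_add, multinomialExp_add, multinomialExp_add, multinomialExp_const_mul,
    multinomialExp_const_mul, multinomialExp_const_mul, multinomialExp_one hu,
    multinomialExp_linear hu, multinomialExp_linear hu, multinomialExp_linear_mul_linear hu,
    ← hα, ← hβ]
  push_cast
  ring

end MultinomialMoments

section PairSums

variable {N : ℕ}

theorem sum_pairIdx_ite_mem (i : Fin N) (f : Finset (Fin N) → ℝ) :
    (∑ s : PairIdx N, if i ∈ s.1 then f s.1 else 0) =
      ∑ k ∈ Finset.univ.erase i, f {i, k} := by
  rw [← Finset.sum_filter]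
  symm
  refine Finset.sum_bij (fun k hk => ⟨{i, k}, Finset.card_pair (Finset.ne_of_mem_erase hk).symm⟩)
    ?_ ?_ ?_ ?_
  · simp
  · intro k hk l hl h
    have hmem : k ∈ ({i, l} : Finset (Fin N)) := by
      rw [← Subtype.mk.inj h]
      simp
    simpa [Finset.ne_of_mem_erase hk] using hmem
  · rintro ⟨s, hs⟩ his
    obtain ⟨k, hk⟩ := Finset.card_eq_one.mp
      ((Finset.card_erase_of_mem (Finset.mem_filter.mp his).2).trans (by rw [hs]))
    have hks : k ∈ s.erase i := hk ▸ Finset.mem_singleton_self k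
    refine ⟨k, by simpa using Finset.ne_of_mem_erase hks, Subtype.ext ?_⟩
    rw [← Finset.insert_erase (Finset.mem_filter.mp his).2, hk]
  · simp

theorem sum_pairIdx_ite_mem_and_mem {i j : Fin N} (hij : i ≠ j) (f : Finset (Fin N) → ℝ) :
    (∑ s : PairIdx N, if i ∈ s.1 then (if j ∈ s.1 then f s.1 else 0) else 0) = f {i, j} := by
  rw [sum_pairIdx_ite_mem i fun s => if j ∈ s then f s else 0]
  rw [Finset.sum_eq_single j]
  · simp
  · intro k _ hkj
    simp [hij.symm, hkj.symm]
  · simp [hij.symm]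

theorem sum_pairU (hN : 3 ≤ N) {p : Fin N → ℝ} (hp : ∑ i, p i = 1) :
    ∑ s, pairU N p s = 1 := by
  have hN' : (3 : ℝ) ≤ N := by exact_mod_cast hN
  have hN1 : (N : ℝ) - 1 ≠ 0 := by linarith
  have h (s : PairIdx N) : ∑ k ∈ s.1, p k = ∑ k, if k ∈ s.1 then p k else 0 := by simp
  simp only [pairU, ← Finset.sum_div, h]
  rw [Finset.sum_comm]
  have hcount (k : Fin N) := sum_pairIdx_ite_mem k fun _ => p k
  simp only [hcount, Finset.sum_const, nsmul_eq_mul,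
    Finset.card_erase_of_mem (Finset.mem_univ _), Finset.card_univ, Fintype.card_fin,
    ← Finset.mul_sum, hp]
  rw [Nat.cast_sub (by omega)]
  simp [hN1]

theorem sum_ite_mem_pairU (hN : 3 ≤ N) {p : Fin N → ℝ} (hp : ∑ i, p i = 1) (i : Fin N) :
    (∑ s : PairIdx N, if i ∈ s.1 then pairU N p s else 0) =
      ((N - 2) * p i + 1) / (N - 1) := by
  have hpair (k : Fin N) (hk : k ∈ Finset.univ.erase i) :
      (∑ l ∈ ({i, k} : Finset (Fin N)), p l) / ((N : ℝ) - 1) = (p i + p k) / (N - 1) := by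
    rw [Finset.sum_pair (Finset.ne_of_mem_erase hk).symm]
  have hrest : ∑ k ∈ Finset.univ.erase i, p k = 1 - p i := by
    rw [← hp, ← Finset.add_sum_erase _ p (Finset.mem_univ i)]
    ring
  simp only [pairU]
  rw [sum_pairIdx_ite_mem i fun s => (∑ k ∈ s, p k) / ((N : ℝ) - 1),
    Finset.sum_congr rfl hpair, ← Finset.sum_div, Finset.sum_add_distrib, hrest,
    Finset.sum_const, Finset.card_erase_of_mem (Finset.mem_univ _), Finset.card_univ,
    Fintype.card_fin, nsmul_eq_mul, Nat.cast_sub (by omega)]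
  push_cast
  ring

end PairSums

/-- in the pair method with `N ≥ 3` parties, the unbiased estimators `p̂_i`
satisfy `Cov[p̂_i, p̂_j] = −(1/n)((1 − p_i − p_j)/(N−2)² + p_i p_j)` for all `i ≠ j`. -/
theorem statement6 (N : ℕ) (hN : 3 ≤ N) (p : Fin N → ℝ)
    (hp0 : ∀ i, 0 ≤ p i) (hp1 : ∑ i, p i = 1) (n : ℕ) (hn : 0 < n) :
    ∀ i j : Fin N, i ≠ j →
      (∑' x : PairIdx N → ℕ,
          multinomialPMF n (pairU N p) x *
            ((pairPhat N n x i - p i) * (pairPhat N n x j - p j))) =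
        -(1 / (n : ℝ)) * ((1 - p i - p j) / ((N : ℝ) - 2) ^ 2 + p i * p j) := by
  intro i j hij
  have hN' : (3 : ℝ) ≤ N := by exact_mod_cast hN
  have hN1 : (N : ℝ) - 1 ≠ 0 := by linarith
  have hN2 : (N : ℝ) - 2 ≠ 0 := by linarith
  have hn' : (n : ℝ) ≠ 0 := by exact_mod_cast hn.ne'
  set c : ℝ := ((N : ℝ) - 1) / ((N : ℝ) - 2) / n with hc
  have hlin (i : Fin N) (v : PairIdx N → ℝ) :
      ∑ s : PairIdx N, (if i ∈ s.1 then c else 0) * v s =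
        c * ∑ s : PairIdx N, if i ∈ s.1 then v s else 0 := by
    simp only [Finset.mul_sum, ite_mul, zero_mul, mul_ite, mul_zero]
  have hcentred (i : Fin N) (x : PairIdx N → ℕ) : pairPhat N n x i - p i =
      ∑ s : PairIdx N, (if i ∈ s.1 then c else 0) * x s -
        n * ∑ s : PairIdx N, (if i ∈ s.1 then c else 0) * pairU N p s := by
    have hdiv : (∑ s : PairIdx N, if i ∈ s.1 then (x s : ℝ) / (n : ℝ) else 0) =
        (∑ s : PairIdx N, if i ∈ s.1 then (x s : ℝ) else 0) / n := by
      simp only [Finset.sum_div, ite_div, zero_div]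
    rw [hlin i fun s => (x s : ℝ), hlin i (pairU N p), sum_ite_mem_pairU hN hp1, pairPhat, hdiv, hc]
    field_simp
    ring
  have hboth : ∑ s : PairIdx N, (if i ∈ s.1 then c else 0) * (if j ∈ s.1 then c else 0) *
      pairU N p s = c ^ 2 * ((p i + p j) / (N - 1)) := by
    rw [← Finset.sum_pair hij, ← sum_pairIdx_ite_mem_and_mem hij
      fun s => (∑ k ∈ s, p k) / ((N : ℝ) - 1), Finset.mul_sum]
    refine Finset.sum_congr rfl fun s _ => ?_
    split_ifs <;> simp [pairU, sq]
  simp only [hcentred]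
  refine (multinomialExp_covariance (sum_pairU hN hp1) hn _ _).trans ?_
  rw [hboth, hlin, hlin, sum_ite_mem_pairU hN hp1, sum_ite_mem_pairU hN hp1, hc]
  field_simp
  ring
end
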